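/- In the cyclotomic BMW algebra B_n^k(R) the following identities hold: (i) Y_i'Y_j' = Y_j'Y_i' for all 1 ≤ i, j ≤ n; (ii) Y_i'X_iY_i'e_i = λ⁻¹e_i = e_iY_i'X_iY_i' for all 1 ≤ i ≤ n−1; (iii) for every integer p and all 1 ≤ i ≤ n−1, e_i(Y_{i+1}')^p = e_i(Y_i')^{−p} and (Y_{i+1}')^p e_i = (Y_i')^{−p}e_i. -/

import Mathlib

/-!
Cyclotomic BMW algebra `B_n^k(R)`, presented as the quotient of the free `R`-algebra on
generators `Y, Y⁻¹, Xᵢ, Xᵢ⁻¹ (1 ≤ i ≤ n-1), eᵢ (1 ≤ i ≤ n-1)` by the defining relations.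
Generators with out-of-range indices are identified with `1` (resp. `0` for the `eᵢ`),
so that the quotient is exactly the cyclotomic BMW algebra.
-/

inductive BMWGen : Type
  | Y : BMWGen
  | Yinv : BMWGen
  | X : ℕ → BMWGen
  | Xinv : ℕ → BMWGen
  | E : ℕ → BMWGen

namespace CBMW

/-- The parameters of a cyclotomic BMW algebra: `n`, `k`, units `q, λ, q₀` and
families `qc` (the `qᵢ`, with `qc 0 = q₀`) and `A` (the `Aᵢ`). -/
structure Params (R : Type) [CommRing R] where
  n : ℕ
  k : ℕ
  q : Rˣ
  lam : Rˣ
  q0 : Rˣ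
  qc : ℕ → R
  A : ℕ → R

variable {R : Type} [CommRing R]

abbrev F (R : Type) [CommRing R] := FreeAlgebra R BMWGen

def fY : F R := FreeAlgebra.ι R BMWGen.Y
def fYi : F R := FreeAlgebra.ι R BMWGen.Yinv
def fX (i : ℕ) : F R := FreeAlgebra.ι R (BMWGen.X i)
def fXi (i : ℕ) : F R := FreeAlgebra.ι R (BMWGen.Xinv i)
def fE (i : ℕ) : F R := FreeAlgebra.ι R (BMWGen.E i)

/-- `δ = q - q⁻¹`. -/
def Params.delta (P : Params R) : R := (P.q : R) - ((P.q⁻¹ : Rˣ) : R)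

/-- `λ⁻¹` as an element of `R`. -/
def Params.laminv (P : Params R) : R := ((P.lam⁻¹ : Rˣ) : R)

/-- The defining relations of the cyclotomic BMW algebra. -/
inductive Rel (P : Params R) : F R → F R → Prop
  | X_inv_right {i : ℕ} (h1 : 1 ≤ i) (h2 : i ≤ P.n - 1) : Rel P (fX i * fXi i) 1
  | X_inv_left {i : ℕ} (h1 : 1 ≤ i) (h2 : i ≤ P.n - 1) : Rel P (fXi i * fX i) 1
  | Y_inv_right : Rel P (fY * fYi) 1
  | Y_inv_left : Rel P (fYi * fY) 1
  | X_invalid {i : ℕ} (h : i = 0 ∨ P.n - 1 < i) : Rel P (fX i) 1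
  | Xi_invalid {i : ℕ} (h : i = 0 ∨ P.n - 1 < i) : Rel P (fXi i) 1
  | E_invalid {i : ℕ} (h : i = 0 ∨ P.n - 1 < i) : Rel P (fE i) 0
  | skein {i : ℕ} (h1 : 1 ≤ i) (h2 : i ≤ P.n - 1) :
      Rel P (fX i - fXi i) (P.delta • ((1 : F R) - fE i))
  | XX_far {i j : ℕ} (h1 : 1 ≤ i) (h2 : i ≤ P.n - 1) (h3 : 1 ≤ j) (h4 : j ≤ P.n - 1)
      (h : i + 2 ≤ j ∨ j + 2 ≤ i) : Rel P (fX i * fX j) (fX j * fX i)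
  | braid {i : ℕ} (h1 : 1 ≤ i) (h2 : i + 1 ≤ P.n - 1) :
      Rel P (fX i * fX (i+1) * fX i) (fX (i+1) * fX i * fX (i+1))
  | XE_far {i j : ℕ} (h1 : 1 ≤ i) (h2 : i ≤ P.n - 1) (h3 : 1 ≤ j) (h4 : j ≤ P.n - 1)
      (h : i + 2 ≤ j ∨ j + 2 ≤ i) : Rel P (fX i * fE j) (fE j * fX i)
  | EE_far {i j : ℕ} (h1 : 1 ≤ i) (h2 : i ≤ P.n - 1) (h3 : 1 ≤ j) (h4 : j ≤ P.n - 1)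
      (h : i + 2 ≤ j ∨ j + 2 ≤ i) : Rel P (fE i * fE j) (fE j * fE i)
  | untwist_right {i : ℕ} (h1 : 1 ≤ i) (h2 : i ≤ P.n - 1) :
      Rel P (fX i * fE i) ((P.lam : R) • fE i)
  | untwist_left {i : ℕ} (h1 : 1 ≤ i) (h2 : i ≤ P.n - 1) :
      Rel P (fE i * fX i) ((P.lam : R) • fE i)
  | XXE {i j : ℕ} (h1 : 1 ≤ i) (h2 : i ≤ P.n - 1) (h3 : 1 ≤ j) (h4 : j ≤ P.n - 1)
      (h : j = i + 1 ∨ i = j + 1) : Rel P (fX i * fX j * fE i) (fE j * fE i)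
  | EXX {i j : ℕ} (h1 : 1 ≤ i) (h2 : i ≤ P.n - 1) (h3 : 1 ≤ j) (h4 : j ≤ P.n - 1)
      (h : j = i + 1 ∨ i = j + 1) : Rel P (fE j * fE i) (fE j * fX i * fX j)
  | EEE_up {i : ℕ} (h1 : 1 ≤ i) (h2 : i + 1 ≤ P.n - 1) :
      Rel P (fE i * fE (i+1) * fE i) (fE i)
  | EEE_down {i : ℕ} (h1 : 1 ≤ i) (h2 : i + 1 ≤ P.n - 1) :
      Rel P (fE (i+1) * fE i * fE (i+1)) (fE (i+1))
  | E_sq {i : ℕ} (h1 : 1 ≤ i) (h2 : i ≤ P.n - 1) : Rel P (fE i * fE i) (P.A 0 • fE i)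
  | cyclo : Rel P (fY ^ P.k) (∑ i ∈ Finset.range P.k, P.qc i • fY ^ i)
  | braidB (h : 2 ≤ P.n) :
      Rel P (fX 1 * fY * fX 1 * fY) (fY * fX 1 * fY * fX 1)
  | YX_comm {i : ℕ} (h1 : 2 ≤ i) (h2 : i ≤ P.n - 1) : Rel P (fY * fX i) (fX i * fY)
  | YE_comm {i : ℕ} (h1 : 2 ≤ i) (h2 : i ≤ P.n - 1) : Rel P (fY * fE i) (fE i * fY)
  | YXYE (h : 2 ≤ P.n) : Rel P (fY * fX 1 * fY * fE 1) (P.laminv • fE 1)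
  | EYXY (h : 2 ≤ P.n) : Rel P (fE 1 * (fY * fX 1 * fY)) (P.laminv • fE 1)
  | EYE {m : ℕ} (h : 2 ≤ P.n) (hm : m ≤ P.k - 1) :
      Rel P (fE 1 * fY ^ m * fE 1) (P.A m • fE 1)

/-- The cyclotomic BMW algebra `B_n^k(R)`. -/
abbrev Alg (P : Params R) := RingQuot (Rel P)

def pr (P : Params R) : F R →ₐ[R] Alg P := RingQuot.mkAlgHom R (Rel P)

/-- The generator `Y`. -/
def Yg (P : Params R) : Alg P := pr P fY
/-- The generator `Y⁻¹`. -/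
def Ygi (P : Params R) : Alg P := pr P fYi
/-- The generator `Xᵢ`. -/
def Xg (P : Params R) (i : ℕ) : Alg P := pr P (fX i)
/-- The generator `Xᵢ⁻¹`. -/
def Xgi (P : Params R) (i : ℕ) : Alg P := pr P (fXi i)
/-- The generator `eᵢ`. -/
def Eg (P : Params R) (i : ℕ) : Alg P := pr P (fE i)

/-- `X₁ X₂ ⋯ X_m`. -/
def upX (P : Params R) : ℕ → Alg P
  | 0 => 1
  | m + 1 => upX P m * Xg P (m + 1)

/-- `X_m ⋯ X₂ X₁`. -/
def downX (P : Params R) : ℕ → Alg P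
  | 0 => 1
  | m + 1 => Xg P (m + 1) * downX P m

/-- `X₁⁻¹ X₂⁻¹ ⋯ X_m⁻¹`. -/
def upXi (P : Params R) : ℕ → Alg P
  | 0 => 1
  | m + 1 => upXi P m * Xgi P (m + 1)

/-- `X_m⁻¹ ⋯ X₂⁻¹ X₁⁻¹`. -/
def downXi (P : Params R) : ℕ → Alg P
  | 0 => 1
  | m + 1 => Xgi P (m + 1) * downXi P m

/-- `Yᵢ' = X_{i-1} ⋯ X₁ Y X₁ ⋯ X_{i-1}`. -/
def Yp (P : Params R) (i : ℕ) : Alg P := downX P (i - 1) * Yg P * upX P (i - 1)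

/-- `(Yᵢ')⁻¹ = X_{i-1}⁻¹ ⋯ X₁⁻¹ Y⁻¹ X₁⁻¹ ⋯ X_{i-1}⁻¹`. -/
def YpInv (P : Params R) (i : ℕ) : Alg P := downXi P (i - 1) * Ygi P * upXi P (i - 1)

/-- `(Yᵢ')^p` for an integer exponent `p`. -/
def Ypow (P : Params R) (i : ℕ) (p : ℤ) : Alg P :=
  if 0 ≤ p then Yp P i ^ p.toNat else YpInv P i ^ (-p).toNat

/-- `Y^{s 1} (Y₂')^{s 2} ⋯ (Y_m')^{s m}`. -/
def YpowProd (P : Params R) (s : ℕ → ℤ) : ℕ → Alg P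
  | 0 => 1
  | m + 1 => YpowProd P s m * Ypow P (m + 1) (s (m + 1))

/-- The subalgebra `B_l` generated by `Y^{±1}, X₁^{±1}, …, X_{l-1}^{±1}, e₁, …, e_{l-1}`. -/
def Bsub (P : Params R) (l : ℕ) : Subalgebra R (Alg P) :=
  Algebra.adjoin R
    ({Yg P, Ygi P} ∪
      {x | ∃ i, 1 ≤ i ∧ i + 1 ≤ l ∧ (x = Xg P i ∨ x = Xgi P i ∨ x = Eg P i)})

/-- `α_{ijl}^p = (Yᵢ')^p Xᵢ ⋯ X_{j-1} e_j ⋯ e_l`. -/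
def alpha (P : Params R) (i j l : ℕ) (p : ℤ) : Alg P :=
  Ypow P i p * ((List.range' i (j - i)).map fun t => Xg P t).prod *
    ((List.range' j (l + 1 - j)).map fun t => Eg P t).prod

/-- The set `P = {⌊k/2⌋ - (k-1), …, ⌊k/2⌋}` of `k` consecutive integers. -/
def Pset (k : ℕ) : Set ℤ := {p | (↑(k / 2) : ℤ) - ((k : ℤ) - 1) ≤ p ∧ p ≤ (↑(k / 2) : ℤ)}

/-- `α_{i₁,j₁,l-1}^{s₁} ⋯ α_{i_m,j_m,l-2m+1}^{s_m}`. -/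
def alphaChain (P : Params R) (l : ℕ) (ii jj : ℕ → ℕ) (ss : ℕ → ℤ) : ℕ → Alg P
  | 0 => 1
  | m + 1 => alphaChain P l ii jj ss m *
      alpha P (ii (m + 1)) (jj (m + 1)) (l + 1 - 2 * (m + 1)) (ss (m + 1))

/-- `α_{i₁,j₁,l-2}^{s₁} ⋯ α_{i_m,j_m,l-2m}^{s_m}`. -/
def alphaChainBar (P : Params R) (l : ℕ) (ii jj : ℕ → ℕ) (ss : ℕ → ℤ) : ℕ → Alg P
  | 0 => 1
  | m + 1 => alphaChainBar P l ii jj ss m *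
      alpha P (ii (m + 1)) (jj (m + 1)) (l - 2 * (m + 1)) (ss (m + 1))

/-- `E_{l,m} = e_{l-1} e_{l-3} ⋯ e_{l-2m+1}`. -/
def Echain (P : Params R) (l : ℕ) : ℕ → Alg P
  | 0 => 1
  | m + 1 => Echain P l m * Eg P (l + 1 - 2 * (m + 1))

/-- The set `V_{l,m}^g`. -/
def Vg (P : Params R) (l m : ℕ) : Set (Alg P) :=
  {x | ∃ ii jj : ℕ → ℕ, ∃ ss : ℕ → ℤ,
    (∀ t, 1 ≤ t → t ≤ m →
      1 ≤ ii t ∧ ii t ≤ jj t ∧ jj t ≤ l + 1 - 2 * t ∧ ss t ∈ Pset P.k) ∧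
    x = alphaChain P l ii jj ss m}

/-- The set `V_{l,m}`. -/
def V (P : Params R) (l m : ℕ) : Set (Alg P) :=
  {x | ∃ ii jj : ℕ → ℕ, ∃ ss : ℕ → ℤ,
    (∀ t, 1 ≤ t → t ≤ m →
      1 ≤ ii t ∧ ii t ≤ jj t ∧ jj t ≤ l + 1 - 2 * t ∧ ss t ∈ Pset P.k) ∧
    (∀ t, 1 ≤ t → t + 1 ≤ m → ii (t + 1) < ii t) ∧
    x = alphaChain P l ii jj ss m}

/-- The set `V̄_{l,m}`. -/
def Vbar (P : Params R) (l m : ℕ) : Set (Alg P) :=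
  {x | ∃ ii jj : ℕ → ℕ, ∃ ss : ℕ → ℤ,
    (∀ t, 1 ≤ t → t ≤ m →
      1 ≤ ii t ∧ ii t ≤ jj t ∧ jj t ≤ l + 1 - 2 * t ∧ ss t ∈ Pset P.k) ∧
    (∀ t, 1 ≤ t → t + 1 ≤ m → ii (t + 1) < ii t) ∧
    x = alphaChainBar P l ii jj ss m}

end CBMW

namespace CBMW

variable {R : Type} [CommRing R]

section Monoid

variable {M : Type*} [Monoid M]

/-- Conjugating `y` by `a` on both sides preserves the type `B` braid relation. -/
theorem braidB_step {a b y : M} (hab : a * b * a = b * a * b) (hby : Commute b y)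
    (hay : a * y * a * y = y * a * y * a) :
    b * (a * y * a) * b * (a * y * a) = a * y * a * b * (a * y * a) * b := by
  have hby := hby.eq
  symm
  calc a * y * a * b * (a * y * a) * b
      = a * y * (a * b * a) * y * a * b := by simp only [mul_assoc]
    _ = a * (y * b) * a * (b * y) * a * b := by rw [hab]; simp only [mul_assoc]
    _ = a * (b * y) * a * (y * b) * a * b := by rw [hby]
    _ = a * b * y * a * y * (b * a * b) := by simp only [mul_assoc]
    _ = a * b * (y * a * y * a) * b * a := by rw [← hab]; simp only [mul_assoc]
    _ = (a * b * a) * y * a * y * b * a := by rw [← hay]; simp only [mul_assoc]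
    _ = b * a * (b * y) * a * (y * b) * a := by rw [hab]; simp only [mul_assoc]
    _ = b * a * (y * b) * a * (b * y) * a := by rw [hby]
    _ = b * a * y * (b * a * b) * y * a := by simp only [mul_assoc]
    _ = b * (a * y * a) * b * (a * y * a) := by rw [← hab]; simp only [mul_assoc]

theorem mul_units_zpow_of_mul_eq_left {e : M} {u v : Mˣ} (huv : Commute u v)
    (h : e * (u * v : M) = e) (p : ℤ) : e * ((u ^ p : Mˣ) : M) = e * ((v ^ (-p) : Mˣ) : M) := by
  have hs : SemiconjBy e ((u * v : Mˣ) : M) ((1 : Mˣ) : M) := by simpa [SemiconjBy] using h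
  have hp := (hs.units_zpow_right p).eq
  rw [one_zpow, Units.val_one, one_mul, huv.mul_zpow, Units.val_mul, ← mul_assoc] at hp
  rw [zpow_neg, Units.eq_mul_inv_iff_mul_eq, hp]

theorem units_zpow_mul_of_mul_eq_right {e : M} {u v : Mˣ} (huv : Commute u v)
    (h : (v * u : M) * e = e) (p : ℤ) : ((u ^ p : Mˣ) : M) * e = ((v ^ (-p) : Mˣ) : M) * e := by
  have hs : SemiconjBy e ((1 : Mˣ) : M) ((v * u : Mˣ) : M) := by simpa [SemiconjBy] using h.symm
  have hp := (hs.units_zpow_right p).eq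
  rw [one_zpow, Units.val_one, mul_one, huv.symm.mul_zpow, Units.val_mul, mul_assoc] at hp
  rw [zpow_neg, Units.eq_inv_mul_iff_mul_eq, ← hp]

end Monoid

section Algebra

variable {S A : Type*} [CommSemiring S] [Semiring A] [Algebra S A]

theorem twist_step_left {a b y e f : A} {c : S} (hab : a * b * a = b * a * b)
    (hby : Commute b y) (hbaf : b * a * f = e * f) (habe : a * b * e = f * e)
    (hfef : f * e * f = f) (h : y * a * y * e = c • e) :
    a * y * a * b * (a * y * a) * f = c • f := by
  have hby := hby.eq
  calc a * y * a * b * (a * y * a) * f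
      = a * y * (a * b * a) * y * a * f := by simp only [mul_assoc]
    _ = a * (y * b) * a * (b * y) * a * f := by rw [hab]; simp only [mul_assoc]
    _ = a * (b * y) * a * (y * b) * a * f := by rw [hby]
    _ = a * b * y * a * y * (b * a * f) := by simp only [mul_assoc]
    _ = a * b * (y * a * y * e) * f := by rw [hbaf]; simp only [mul_assoc]
    _ = c • (a * b * e * f) := by rw [h]; simp only [mul_smul_comm, smul_mul_assoc]
    _ = c • f := by rw [habe, hfef]

theorem twist_step_right {a b y e f : A} {c : S} (hab : a * b * a = b * a * b)
    (hby : Commute b y) (hfab : f * e = f * a * b) (heba : e * f = e * b * a)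
    (hfef : f * e * f = f) (h : e * (y * a * y) = c • e) :
    f * (a * y * a * b * (a * y * a)) = c • f := by
  have hby := hby.eq
  calc f * (a * y * a * b * (a * y * a))
      = f * a * y * (a * b * a) * y * a := by simp only [mul_assoc]
    _ = f * a * (y * b) * a * (b * y) * a := by rw [hab]; simp only [mul_assoc]
    _ = f * a * (b * y) * a * (y * b) * a := by rw [hby]
    _ = (f * a * b) * y * a * y * b * a := by simp only [mul_assoc]
    _ = f * (e * (y * a * y)) * b * a := by rw [← hfab]; simp only [mul_assoc]
    _ = c • (f * (e * b * a)) := by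
      rw [h]; simp only [mul_smul_comm, smul_mul_assoc, mul_assoc]
    _ = c • f := by rw [← heba, ← mul_assoc, hfef]

end Algebra

variable (P : Params R)

theorem pr_eq_of_rel {a b : F R} (h : Rel P a b) : pr P a = pr P b :=
  RingQuot.mkAlgHom_rel R h

theorem Xg_mul_Xgi (i : ℕ) : Xg P i * Xgi P i = 1 := by
  by_cases h : i = 0 ∨ P.n - 1 < i
  · have hX := pr_eq_of_rel P (.X_invalid h)
    have hXi := pr_eq_of_rel P (.Xi_invalid h)
    simp only [Xg, Xgi, hX, hXi, map_one, mul_one]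
  · simpa [Xg, Xgi] using pr_eq_of_rel P (.X_inv_right (i := i) (by omega) (by omega))

theorem Xgi_mul_Xg (i : ℕ) : Xgi P i * Xg P i = 1 := by
  by_cases h : i = 0 ∨ P.n - 1 < i
  · have hX := pr_eq_of_rel P (.X_invalid h)
    have hXi := pr_eq_of_rel P (.Xi_invalid h)
    simp only [Xg, Xgi, hX, hXi, map_one, mul_one]
  · simpa [Xg, Xgi] using pr_eq_of_rel P (.X_inv_left (i := i) (by omega) (by omega))

/-- The unit `Xᵢ`. -/
def Xunit (i : ℕ) : (Alg P)ˣ := ⟨Xg P i, Xgi P i, Xg_mul_Xgi P i, Xgi_mul_Xg P i⟩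

/-- The unit `Y'_{m+1}`. -/
def Yunit : ℕ → (Alg P)ˣ
  | 0 => ⟨Yg P, Ygi P, by simpa [Yg, Ygi] using pr_eq_of_rel P .Y_inv_right,
      by simpa [Yg, Ygi] using pr_eq_of_rel P .Y_inv_left⟩
  | m + 1 => Xunit P (m + 1) * Yunit m * Xunit P (m + 1)

theorem Yp_one : Yp P 1 = Yg P := by simp [Yp, downX, upX]

theorem Yp_succ (m : ℕ) : Yp P (m + 2) = Xg P (m + 1) * Yp P (m + 1) * Xg P (m + 1) := by
  simp [Yp, downX, upX, mul_assoc]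

theorem YpInv_succ (m : ℕ) :
    YpInv P (m + 2) = Xgi P (m + 1) * YpInv P (m + 1) * Xgi P (m + 1) := by
  simp [YpInv, downXi, upXi, mul_assoc]

theorem val_Yunit (m : ℕ) : (Yunit P m : Alg P) = Yp P (m + 1) := by
  induction m with
  | zero => exact (Yp_one P).symm
  | succ m ih => rw [Yp_succ, ← ih]; rfl

theorem val_inv_Yunit (m : ℕ) : ((Yunit P m)⁻¹ : (Alg P)ˣ) = YpInv P (m + 1) := by
  induction m with
  | zero => simp [Yunit, YpInv, downXi, upXi]
  | succ m ih => rw [YpInv_succ, ← ih]; simp [Yunit, Xunit, mul_assoc]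

theorem Ypow_eq_zpow (m : ℕ) (p : ℤ) :
    Ypow P (m + 1) p = ((Yunit P m ^ p : (Alg P)ˣ) : Alg P) := by
  unfold Ypow
  split_ifs with h
  · obtain ⟨k, rfl⟩ := Int.eq_ofNat_of_zero_le h
    simp [val_Yunit]
  · obtain ⟨k, hk⟩ := Int.eq_ofNat_of_zero_le (a := -p) (by omega)
    obtain rfl : p = -(k : ℤ) := by omega
    rw [zpow_neg, zpow_natCast, ← inv_pow, Units.val_pow_eq_pow_val, val_inv_Yunit]
    simp

variable {P}

theorem Xg_mul_Xg_mul_Xg {i : ℕ} (h1 : 1 ≤ i) (h2 : i + 1 ≤ P.n - 1) :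
    Xg P i * Xg P (i + 1) * Xg P i = Xg P (i + 1) * Xg P i * Xg P (i + 1) := by
  simpa [Xg] using pr_eq_of_rel P (.braid h1 h2)

theorem commute_Xg_Yp {m j : ℕ} (hmj : m + 1 < j) (hj : j ≤ P.n - 1) :
    Commute (Xg P j) (Yp P (m + 1)) := by
  induction m with
  | zero =>
    rw [Yp_one]
    have h := pr_eq_of_rel P (.YX_comm (i := j) (by omega) hj)
    rw [map_mul, map_mul] at h
    exact h.symm
  | succ m ih =>
    rw [Yp_succ]
    have h := pr_eq_of_rel P (.XX_far (i := j) (j := m + 1) (by omega) hj (by omega) (by omega)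
      (by omega))
    rw [map_mul, map_mul] at h
    have hX : Commute (Xg P j) (Xg P (m + 1)) := h
    exact (hX.mul_right (ih (by omega))).mul_right hX

theorem Xg_mul_Yp_mul_Xg_mul_Yp {m : ℕ} (hm : m + 1 ≤ P.n - 1) :
    Xg P (m + 1) * Yp P (m + 1) * Xg P (m + 1) * Yp P (m + 1) =
      Yp P (m + 1) * Xg P (m + 1) * Yp P (m + 1) * Xg P (m + 1) := by
  induction m with
  | zero =>
    simpa [Yp_one, Xg, Yg] using pr_eq_of_rel P (.braidB (by omega))
  | succ m ih =>
    rw [Yp_succ]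
    exact braidB_step (Xg_mul_Xg_mul_Xg (by omega) hm) (commute_Xg_Yp (by omega) hm)
      (ih (by omega))

theorem commute_Yp_succ {m : ℕ} (hm : m + 1 ≤ P.n - 1) :
    Commute (Yp P (m + 1)) (Yp P (m + 2)) := by
  rw [Yp_succ]
  have h := Xg_mul_Yp_mul_Xg_mul_Yp hm
  simpa only [Commute, SemiconjBy, mul_assoc] using h.symm

theorem commute_Yp_Yp {i j : ℕ} (hij : i ≤ j) (hj : j + 1 ≤ P.n) :
    Commute (Yp P (i + 1)) (Yp P (j + 1)) := by
  induction j, hij using Nat.le_induction with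
  | base => exact Commute.refl _
  | succ j hij ih =>
    rcases hij.eq_or_lt with rfl | hlt
    · exact commute_Yp_succ (by omega)
    · have hX := (commute_Xg_Yp (P := P) (m := i) (j := j + 1) (by omega) (by omega)).symm
      rw [Yp_succ]
      exact (hX.mul_right (ih (by omega))).mul_right hX

theorem Eg_succ_mul_Eg_mul_Eg_succ {i : ℕ} (h1 : 1 ≤ i) (h2 : i + 1 ≤ P.n - 1) :
    Eg P (i + 1) * Eg P i * Eg P (i + 1) = Eg P (i + 1) := by
  simpa [Eg] using pr_eq_of_rel P (.EEE_down h1 h2)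

theorem Xg_mul_Xg_mul_Eg {i j : ℕ} (h1 : 1 ≤ i) (h2 : i ≤ P.n - 1) (h3 : 1 ≤ j)
    (h4 : j ≤ P.n - 1) (h : j = i + 1 ∨ i = j + 1) :
    Xg P i * Xg P j * Eg P i = Eg P j * Eg P i := by
  simpa [Xg, Eg] using pr_eq_of_rel P (.XXE h1 h2 h3 h4 h)

theorem Eg_mul_Eg {i j : ℕ} (h1 : 1 ≤ i) (h2 : i ≤ P.n - 1) (h3 : 1 ≤ j)
    (h4 : j ≤ P.n - 1) (h : j = i + 1 ∨ i = j + 1) :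
    Eg P j * Eg P i = Eg P j * Xg P i * Xg P j := by
  simpa [Xg, Eg] using pr_eq_of_rel P (.EXX h1 h2 h3 h4 h)

theorem Yp_mul_Xg_mul_Yp_mul_Eg {m : ℕ} (hm : m + 1 ≤ P.n - 1) :
    Yp P (m + 1) * Xg P (m + 1) * Yp P (m + 1) * Eg P (m + 1) = P.laminv • Eg P (m + 1) := by
  induction m with
  | zero =>
    simpa [Yp_one, Xg, Yg, Eg] using pr_eq_of_rel P (.YXYE (by omega))
  | succ m ih =>
    rw [Yp_succ]
    exact twist_step_left (Xg_mul_Xg_mul_Xg (by omega) hm) (commute_Xg_Yp (by omega) hm)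
      (Xg_mul_Xg_mul_Eg (by omega) hm (by omega) (by omega) (.inr rfl))
      (Xg_mul_Xg_mul_Eg (by omega) (by omega) (by omega) hm (.inl rfl))
      (Eg_succ_mul_Eg_mul_Eg_succ (by omega) hm) (ih (by omega))

theorem Eg_mul_Yp_mul_Xg_mul_Yp {m : ℕ} (hm : m + 1 ≤ P.n - 1) :
    Eg P (m + 1) * (Yp P (m + 1) * Xg P (m + 1) * Yp P (m + 1)) = P.laminv • Eg P (m + 1) := by
  induction m with
  | zero =>
    simpa [Yp_one, Xg, Yg, Eg] using pr_eq_of_rel P (.EYXY (by omega))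
  | succ m ih =>
    rw [Yp_succ]
    exact twist_step_right (Xg_mul_Xg_mul_Xg (by omega) hm) (commute_Xg_Yp (by omega) hm)
      (Eg_mul_Eg (by omega) (by omega) (by omega) hm (.inl rfl))
      (Eg_mul_Eg (by omega) hm (by omega) (by omega) (.inr rfl))
      (Eg_succ_mul_Eg_mul_Eg_succ (by omega) hm) (ih (by omega))

theorem lam_smul_laminv_smul (x : Alg P) : (P.lam : R) • P.laminv • x = x := by
  rw [smul_smul, Params.laminv, Units.mul_inv, one_smul]

theorem Eg_mul_Yp_succ_mul_Yp {m : ℕ} (hm : m + 1 ≤ P.n - 1) :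
    Eg P (m + 1) * (Yp P (m + 2) * Yp P (m + 1)) = Eg P (m + 1) := by
  have hX : Eg P (m + 1) * Xg P (m + 1) = (P.lam : R) • Eg P (m + 1) := by
    simpa [Xg, Eg] using pr_eq_of_rel P (.untwist_left (by omega) hm)
  rw [Yp_succ]
  calc _ = Eg P (m + 1) * Xg P (m + 1) * (Yp P (m + 1) * Xg P (m + 1) * Yp P (m + 1)) := by
        simp only [mul_assoc]
    _ = _ := by rw [hX, smul_mul_assoc, Eg_mul_Yp_mul_Xg_mul_Yp hm, lam_smul_laminv_smul]

theorem Yp_mul_Yp_succ_mul_Eg {m : ℕ} (hm : m + 1 ≤ P.n - 1) :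
    Yp P (m + 1) * Yp P (m + 2) * Eg P (m + 1) = Eg P (m + 1) := by
  have hX : Xg P (m + 1) * Eg P (m + 1) = (P.lam : R) • Eg P (m + 1) := by
    simpa [Xg, Eg] using pr_eq_of_rel P (.untwist_right (by omega) hm)
  rw [Yp_succ]
  calc _ = Yp P (m + 1) * Xg P (m + 1) * Yp P (m + 1) * (Xg P (m + 1) * Eg P (m + 1)) := by
        simp only [mul_assoc]
    _ = _ := by rw [hX, mul_smul_comm, Yp_mul_Xg_mul_Yp_mul_Eg hm, lam_smul_laminv_smul]

theorem commute_Yunit_succ {m : ℕ} (hm : m + 1 ≤ P.n - 1) :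
    Commute (Yunit P (m + 1)) (Yunit P m) := by
  refine Units.ext ?_
  simpa only [Units.val_mul, val_Yunit] using (commute_Yp_succ hm).symm.eq

end CBMW

open CBMW

/-- (i) The `Yᵢ'` commute pairwise; (ii) `Yᵢ'XᵢYᵢ'eᵢ = λ⁻¹eᵢ = eᵢYᵢ'XᵢYᵢ'`;
(iii) `eᵢ(Y_{i+1}')^p = eᵢ(Yᵢ')^{-p}` and `(Y_{i+1}')^p eᵢ = (Yᵢ')^{-p}eᵢ` for all integers `p`. -/
theorem statement1 {R : Type} [CommRing R] (P : Params R)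
    (hn : 1 ≤ P.n) (hk : 1 ≤ P.k) (hq0 : P.qc 0 = (P.q0 : R))
    (hcomp : (P.lam : R) - P.laminv = P.delta * (1 - P.A 0)) :
    (∀ i j, 1 ≤ i → i ≤ P.n → 1 ≤ j → j ≤ P.n →
      Yp P i * Yp P j = Yp P j * Yp P i) ∧
    (∀ i, 1 ≤ i → i ≤ P.n - 1 →
      Yp P i * Xg P i * Yp P i * Eg P i = P.laminv • Eg P i ∧
      Eg P i * (Yp P i * Xg P i * Yp P i) = P.laminv • Eg P i) ∧
    (∀ (p : ℤ) (i : ℕ), 1 ≤ i → i ≤ P.n - 1 →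
      Eg P i * Ypow P (i + 1) p = Eg P i * Ypow P i (-p) ∧
      Ypow P (i + 1) p * Eg P i = Ypow P i (-p) * Eg P i) := by
  refine ⟨fun i j hi hin hj hjn => ?_, fun i hi hin => ?_, fun p i hi hin => ?_⟩
  · obtain ⟨i, rfl⟩ := Nat.exists_eq_add_of_le' hi
    obtain ⟨j, rfl⟩ := Nat.exists_eq_add_of_le' hj
    rcases le_total i j with h | h
    · exact (commute_Yp_Yp h hjn).eq
    · exact (commute_Yp_Yp h hin).eq.symm
  · obtain ⟨m, rfl⟩ := Nat.exists_eq_add_of_le' hi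
    exact ⟨Yp_mul_Xg_mul_Yp_mul_Eg hin, Eg_mul_Yp_mul_Xg_mul_Yp hin⟩
  · obtain ⟨m, rfl⟩ := Nat.exists_eq_add_of_le' hi
    simp only [Ypow_eq_zpow]
    refine ⟨mul_units_zpow_of_mul_eq_left (commute_Yunit_succ hin) ?_ p,
      units_zpow_mul_of_mul_eq_right (commute_Yunit_succ hin) ?_ p⟩
    · simpa only [val_Yunit] using Eg_mul_Yp_succ_mul_Yp hin
    · simpa only [val_Yunit] using Yp_mul_Yp_succ_mul_Eg hin
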